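/- Let x,y ∈ {-1,1}^n be random with (x_i,y_i) independent across i, uniform marginals, and |E[x_i y_i]| ≤ ρ for all i. If P[x ∈ B1] ≥ ε and P[y ∈ B2] ≥ ε for 0 < ε ≤ 1, then P[x ∈ B1, y ∈ B2] ≥ ε^{2/(1-ρ)}. -/

import Mathlib

/-- The ±1 value of a bit. -/
noncomputable def sgn (b : Bool) : ℝ := if b then 1 else -1

open Real in
/-- Convexity of `s ↦ log ((1 + s) / (1 - s))` on `[0, 1)`, along segments through the origin. -/
theorem log_sub_log_mul_le {ρ s : ℝ} (hρ0 : 0 ≤ ρ) (hρ1 : ρ ≤ 1) (hs0 : 0 ≤ s) (hs1 : s < 1) :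
    log (1 + ρ * s) - log (1 - ρ * s) ≤ ρ * (log (1 + s) - log (1 - s)) := by
  have hρs : ρ * s ≤ s := mul_le_of_le_one_left hs0 hρ1
  have h₁ := hasSum_log_sub_log_of_abs_lt_one (x := s) (by rwa [abs_of_nonneg hs0])
  have h₂ := hasSum_log_sub_log_of_abs_lt_one (x := ρ * s)
    (by rw [abs_of_nonneg (by positivity)]; linarith)
  refine hasSum_le (fun k => ?_) h₂ (h₁.mul_left ρ)
  have hk : ρ ^ (2 * k + 1) ≤ ρ := pow_le_of_le_one hρ0 hρ1 (by omega)
  calc (2 : ℝ) * (1 / (2 * k + 1)) * (ρ * s) ^ (2 * k + 1)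
      = ρ ^ (2 * k + 1) * (2 * (1 / (2 * k + 1)) * s ^ (2 * k + 1)) := by rw [mul_pow]; ring
    _ ≤ ρ * (2 * (1 / (2 * k + 1)) * s ^ (2 * k + 1)) := by gcongr

/-- The inequality `ρ tanh u ≤ tanh (ρ u)` with `s = tanh u`, cleared of denominators. -/
theorem mul_rpow_add_rpow_le_rpow_sub_rpow {ρ s : ℝ} (hρ0 : 0 ≤ ρ) (hρ1 : ρ ≤ 1)
    (hs0 : 0 ≤ s) (hs1 : s < 1) :
    ρ * s * ((1 + s) ^ ρ + (1 - s) ^ ρ) ≤ (1 + s) ^ ρ - (1 - s) ^ ρ := by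
  have hρs : ρ * s ≤ s := mul_le_of_le_one_left hs0 hρ1
  have hρs0 : 0 ≤ ρ * s := by positivity
  have key : (1 + ρ * s) * (1 - s) ^ ρ ≤ (1 - ρ * s) * (1 + s) ^ ρ := by
    have hx : 0 < 1 - s := by linarith
    have hy : 0 < 1 + s := by linarith
    have hz : 0 < 1 - ρ * s := by linarith
    have hw : 0 < 1 + ρ * s := by linarith
    rw [← Real.log_le_log_iff (by positivity) (by positivity),
      Real.log_mul hw.ne' (by positivity), Real.log_mul hz.ne' (by positivity),
      Real.log_rpow hx, Real.log_rpow hy]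
    linarith [log_sub_log_mul_le hρ0 hρ1 hs0 hs1]
  linarith

theorem antitoneOn_rpow_add_rpow_mul_rpow {ρ : ℝ} (hρ0 : 0 ≤ ρ) (hρ1 : ρ < 1) :
    AntitoneOn (fun s : ℝ => ((1 + s) ^ (1 - ρ) + (1 - s) ^ (1 - ρ)) *
      (1 - ρ * s ^ 2) ^ (-((1 - ρ) / 2))) (Set.Icc 0 1) := by
  have hD : ∀ s ∈ Set.Icc (0 : ℝ) 1, 0 < 1 - ρ * s ^ 2 := fun s hs => by
    have : s ^ 2 ≤ 1 := pow_le_one₀ hs.1 hs.2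
    nlinarith
  have hderiv : ∀ s ∈ Set.Ioo (0 : ℝ) 1, HasDerivAt
      (fun s : ℝ => ((1 + s) ^ (1 - ρ) + (1 - s) ^ (1 - ρ)) *
        (1 - ρ * s ^ 2) ^ (-((1 - ρ) / 2)))
      ((1 * (1 - ρ) * (1 + s) ^ (1 - ρ - 1) + -1 * (1 - ρ) * (1 - s) ^ (1 - ρ - 1)) *
          (1 - ρ * s ^ 2) ^ (-((1 - ρ) / 2)) +
        ((1 + s) ^ (1 - ρ) + (1 - s) ^ (1 - ρ)) *
          (-(ρ * (2 * s)) * (-((1 - ρ) / 2)) * (1 - ρ * s ^ 2) ^ (-((1 - ρ) / 2) - 1))) s := by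
    intro s hs
    have hs' := hD s ⟨hs.1.le, hs.2.le⟩
    have h₁ : HasDerivAt (fun s : ℝ => 1 + s) 1 s := (hasDerivAt_id s).const_add 1
    have h₂ : HasDerivAt (fun s : ℝ => 1 - s) (-1) s := (hasDerivAt_id s).const_sub 1
    have h₃ : HasDerivAt (fun s : ℝ => 1 - ρ * s ^ 2) (-(ρ * (2 * s))) s := by
      simpa using ((hasDerivAt_pow 2 s).const_mul ρ).const_sub 1
    exact ((h₁.rpow_const (Or.inl (by linarith [hs.1]))).add
      (h₂.rpow_const (Or.inl (by linarith [hs.2])))).mul (h₃.rpow_const (Or.inl hs'.ne'))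
  refine antitoneOn_of_deriv_nonpos (convex_Icc 0 1) ?_ ?_ ?_
  · refine ContinuousOn.mul (ContinuousOn.add ?_ ?_) ?_
    · exact ContinuousOn.rpow_const (by fun_prop) fun _ _ => Or.inr (by linarith)
    · exact ContinuousOn.rpow_const (by fun_prop) fun _ _ => Or.inr (by linarith)
    · exact ContinuousOn.rpow_const (by fun_prop) fun s hs => Or.inl (hD s hs).ne'
  · rw [interior_Icc]
    exact fun s hs => (hderiv s hs).differentiableAt.differentiableWithinAt
  · rw [interior_Icc]
    intro s hs
    rw [(hderiv s hs).deriv]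
    have hs' := hD s ⟨hs.1.le, hs.2.le⟩
    have hx : 0 < 1 - s := by linarith [hs.2]
    have hy : 0 < 1 + s := by linarith [hs.1]
    have key := mul_rpow_add_rpow_le_rpow_sub_rpow hρ0 hρ1.le hs.1.le hs.2
    have hDpow : (1 - ρ * s ^ 2) ^ (-((1 - ρ) / 2)) =
        (1 - ρ * s ^ 2) ^ (-((1 - ρ) / 2) - 1) * (1 - ρ * s ^ 2) := by
      rw [Real.rpow_sub_one hs'.ne']
      field_simp
    rw [hDpow, show 1 - ρ - 1 = -ρ by ring, Real.rpow_neg hx.le, Real.rpow_neg hy.le,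
      Real.rpow_sub hx, Real.rpow_sub hy, Real.rpow_one, Real.rpow_one]
    have hA : 0 < (1 + s) ^ ρ := by positivity
    have hB : 0 < (1 - s) ^ ρ := by positivity
    have hE : 0 < (1 - ρ * s ^ 2) ^ (-((1 - ρ) / 2) - 1) := by positivity
    generalize (1 + s) ^ ρ = A at *
    generalize (1 - s) ^ ρ = B at *
    generalize (1 - ρ * s ^ 2) ^ (-((1 - ρ) / 2) - 1) = E at *
    have hfactor : (1 * (1 - ρ) * A⁻¹ + -1 * (1 - ρ) * B⁻¹) * (E * (1 - ρ * s ^ 2)) +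
        ((1 + s) / A + (1 - s) / B) * (-(ρ * (2 * s)) * (-((1 - ρ) / 2)) * E) =
        (1 - ρ) * E / (A * B) * (ρ * s * (A + B) - (A - B)) := by
      field_simp
      ring
    rw [hfactor]
    have : 0 < 1 - ρ := by linarith
    exact mul_nonpos_of_nonneg_of_nonpos (by positivity) (by linarith)

theorem rpow_add_rpow_le_two_mul_rpow {ρ s : ℝ} (hρ0 : 0 ≤ ρ) (hρ1 : ρ < 1)
    (hs0 : 0 ≤ s) (hs1 : s ≤ 1) :
    (1 + s) ^ (1 - ρ) + (1 - s) ^ (1 - ρ) ≤ 2 * (1 - ρ * s ^ 2) ^ ((1 - ρ) / 2) := by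
  have hD : 0 < 1 - ρ * s ^ 2 := by
    have : s ^ 2 ≤ 1 := pow_le_one₀ hs0 hs1
    nlinarith
  have h := antitoneOn_rpow_add_rpow_mul_rpow hρ0 hρ1 (Set.left_mem_Icc.2 zero_le_one)
    (Set.mem_Icc.2 ⟨hs0, hs1⟩) hs0
  norm_num at h
  rwa [Real.rpow_neg hD.le, ← div_eq_mul_inv, div_le_iff₀ (by positivity)] at h

/-- The `(1 - ρ)`-mean of two nonnegative reals `u, v` is at most
`√(a² - ρ d²)`, where `a = (u + v) / 2` and `d = (u - v) / 2`. -/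
theorem rpow_mean_le_sqrt {ρ u v : ℝ} (hρ0 : 0 ≤ ρ) (hρ1 : ρ < 1) (hu : 0 ≤ u) (hv : 0 ≤ v) :
    ((u ^ (1 - ρ) + v ^ (1 - ρ)) / 2) ^ (1 / (1 - ρ)) ≤
      √(((u + v) / 2) ^ 2 - ρ * ((u - v) / 2) ^ 2) := by
  wlog huv : v ≤ u generalizing u v
  · have := this hv hu (le_of_not_ge huv)
    rwa [add_comm (v ^ _), add_comm v, ← neg_sub u v, neg_div, neg_sq] at this
  have hp : 0 < 1 - ρ := by linarith
  obtain rfl | hu' := hu.eq_or_lt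
  · obtain rfl : v = 0 := le_antisymm huv hv
    simp [Real.zero_rpow hp.ne', Real.zero_rpow (inv_ne_zero hp.ne')]
  obtain ⟨a, ha⟩ : ∃ a, a = (u + v) / 2 := ⟨_, rfl⟩
  have ha0 : 0 < a := by rw [ha]; linarith
  obtain ⟨s, hs⟩ : ∃ s, s = (u - v) / 2 / a := ⟨_, rfl⟩
  have hsa : s * a = (u - v) / 2 := by rw [hs]; field_simp
  have hs0 : 0 ≤ s := by rw [hs]; exact div_nonneg (by linarith) ha0.le
  have hs1 : s ≤ 1 := by rw [hs, div_le_one ha0]; linarith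
  have hD : 0 ≤ 1 - ρ * s ^ 2 := by
    have : s ^ 2 ≤ 1 := pow_le_one₀ hs0 hs1
    nlinarith
  have hu_eq : u = a * (1 + s) := by linarith
  have hv_eq : v = a * (1 - s) := by linarith
  have hrhs : ((u + v) / 2) ^ 2 - ρ * ((u - v) / 2) ^ 2 = a ^ 2 * (1 - ρ * s ^ 2) := by
    rw [← ha, ← hsa]; ring
  rw [hrhs, Real.sqrt_mul (by positivity), Real.sqrt_sq ha0.le, one_div,
    Real.rpow_inv_le_iff_of_pos (by positivity) (by positivity) hp,
    Real.mul_rpow ha0.le (by positivity), hu_eq, hv_eq, Real.mul_rpow ha0.le (by linarith),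
    Real.mul_rpow ha0.le (by linarith), Real.sqrt_eq_rpow, ← Real.rpow_mul hD,
    show 1 / 2 * (1 - ρ) = (1 - ρ) / 2 by ring]
  have h := mul_le_mul_of_nonneg_left (rpow_add_rpow_le_two_mul_rpow hρ0 hρ1 hs0 hs1)
    (Real.rpow_nonneg ha0.le (1 - ρ))
  linarith

theorem sqrt_mul_sqrt_le_add_mul {ρ r a b d e : ℝ} (hρ0 : 0 ≤ ρ) (hρ1 : ρ ≤ 1) (hr : |r| ≤ ρ)
    (hd : |d| ≤ a) (he : |e| ≤ b) :
    √(a ^ 2 - ρ * d ^ 2) * √(b ^ 2 - ρ * e ^ 2) ≤ a * b + r * (d * e) := by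
  have hde : |d| * |e| ≤ a * b := mul_le_mul hd he (abs_nonneg e) ((abs_nonneg d).trans hd)
  have hde0 : 0 ≤ |d| * |e| := by positivity
  have hd2 : d ^ 2 ≤ a ^ 2 := sq_le_sq.2 (hd.trans (le_abs_self a))
  have h₁ : -(ρ * (|d| * |e|)) ≤ r * (d * e) := by
    refine (neg_le_neg ?_).trans (neg_abs_le _)
    rw [abs_mul, abs_mul]
    gcongr
  refine le_trans ?_ (show a * b - ρ * (|d| * |e|) ≤ _ by linarith)
  rw [← Real.sqrt_mul (by nlinarith [sq_nonneg d])]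
  refine Real.sqrt_le_iff.2 ⟨by nlinarith, ?_⟩
  rw [← sq_abs d, ← sq_abs e]
  nlinarith [mul_nonneg hρ0 (sq_nonneg (a * |e| - b * |d|))]

/-- Two-function reverse hypercontractivity on the two-point space. -/
theorem two_point_reverse_hypercontractive {ρ : ℝ} (hρ0 : 0 ≤ ρ) (hρ1 : ρ < 1)
    (ν : Bool × Bool → ℝ)
    (hx : ∀ b, ν (b, true) + ν (b, false) = 1 / 2)
    (hy : ∀ b, ν (true, b) + ν (false, b) = 1 / 2)
    (hcor : |∑ p : Bool × Bool, ν p * (sgn p.1 * sgn p.2)| ≤ ρ)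
    (f g : Bool → ℝ) (hf : ∀ b, 0 ≤ f b) (hg : ∀ b, 0 ≤ g b) :
    ((∑ a, f a ^ (1 - ρ)) / 2) ^ (1 / (1 - ρ)) * ((∑ b, g b ^ (1 - ρ)) / 2) ^ (1 / (1 - ρ)) ≤
      ∑ a, ∑ b, ν (a, b) * (f a * g b) := by
  have hcor_eq : ∑ p : Bool × Bool, ν p * (sgn p.1 * sgn p.2) = 4 * ν (true, true) - 1 := by
    simp only [Fintype.sum_prod_type, Fintype.sum_bool, sgn]
    norm_num
    linarith [hx true, hx false, hy true, hy false]
  rw [hcor_eq] at hcor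
  have hbound : ∀ h : Bool → ℝ, (∀ b, 0 ≤ h b) →
      |(h true - h false) / 2| ≤ (h true + h false) / 2 := fun h hh => by
    rw [abs_le]
    constructor <;> linarith [hh true, hh false]
  simp only [Fintype.sum_bool]
  calc _ ≤ _ := mul_le_mul (rpow_mean_le_sqrt hρ0 hρ1 (hf true) (hf false))
        (rpow_mean_le_sqrt hρ0 hρ1 (hg true) (hg false))
        (Real.rpow_nonneg (by have := hg true; have := hg false; positivity) _)
        (Real.sqrt_nonneg _)
    _ ≤ _ := sqrt_mul_sqrt_le_add_mul hρ0 hρ1.le hcor (hbound f hf) (hbound g hg)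
    _ = _ := by
      rw [show ν (true, false) = 1 / 2 - ν (true, true) by linarith [hx true],
        show ν (false, true) = 1 / 2 - ν (true, true) by linarith [hy true],
        show ν (false, false) = ν (true, true) by linarith [hx true, hy false]]
      ring

theorem sum_cube_succ {n : ℕ} (F : (Fin (n + 1) → Bool) → ℝ) :
    ∑ x, F x = ∑ a, ∑ x : Fin n → Bool, F (Fin.cons a x) := by
  rw [← (Fin.consEquiv fun _ => Bool).sum_comp, Fintype.sum_prod_type]
  rfl

/-- Two-function reverse hypercontractivity on the discrete cube. -/
theorem reverse_hypercontractive {ρ : ℝ} (hρ0 : 0 ≤ ρ) (hρ1 : ρ < 1) (n : ℕ)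
    (μ : Fin n → Bool × Bool → ℝ) (hnn : ∀ i p, 0 ≤ μ i p)
    (hx : ∀ i b, μ i (b, true) + μ i (b, false) = 1 / 2)
    (hy : ∀ i b, μ i (true, b) + μ i (false, b) = 1 / 2)
    (hcor : ∀ i, |∑ p : Bool × Bool, μ i p * (sgn p.1 * sgn p.2)| ≤ ρ)
    (f g : (Fin n → Bool) → ℝ) (hf : ∀ x, 0 ≤ f x) (hg : ∀ y, 0 ≤ g y) :
    ((∑ x, f x ^ (1 - ρ)) / 2 ^ n) ^ (1 / (1 - ρ)) *
        ((∑ y, g y ^ (1 - ρ)) / 2 ^ n) ^ (1 / (1 - ρ)) ≤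
      ∑ x, ∑ y, (∏ i, μ i (x i, y i)) * (f x * g y) := by
  have hp : 1 - ρ ≠ 0 := by linarith
  induction n with
  | zero =>
    simp only [Fintype.sum_unique, pow_zero, div_one, Finset.univ_eq_empty, Finset.prod_empty,
      one_mul, ← Real.rpow_mul (hf _), ← Real.rpow_mul (hg _), mul_one_div_cancel hp,
      Real.rpow_one, le_refl]
  | succ n ih =>
    have hmean : ∀ h : (Fin (n + 1) → Bool) → ℝ, (∀ x, 0 ≤ h x) →
        (∑ x, h x ^ (1 - ρ)) / 2 ^ (n + 1) =
        (∑ a, (((∑ x : Fin n → Bool, h (Fin.cons a x) ^ (1 - ρ)) / 2 ^ n) ^ (1 / (1 - ρ))) ^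
          (1 - ρ)) / 2 := by
      intro h hh
      have hnonneg : ∀ a, 0 ≤ (∑ x : Fin n → Bool, h (Fin.cons a x) ^ (1 - ρ)) / 2 ^ n :=
        fun a => div_nonneg (Finset.sum_nonneg fun x _ => Real.rpow_nonneg (hh _) _)
          (by positivity)
      simp only [← Real.rpow_mul (hnonneg _), one_div_mul_cancel hp, Real.rpow_one]
      rw [sum_cube_succ, ← Finset.sum_div, div_div, pow_succ]
    rw [hmean f hf, hmean g hg]
    refine (two_point_reverse_hypercontractive hρ0 hρ1 (μ 0) (hx 0) (hy 0) (hcor 0) _ _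
      (fun a => ?_) (fun b => ?_)).trans ?_
    · exact Real.rpow_nonneg (div_nonneg (Finset.sum_nonneg fun x _ =>
        Real.rpow_nonneg (hf _) _) (by positivity)) _
    · exact Real.rpow_nonneg (div_nonneg (Finset.sum_nonneg fun x _ =>
        Real.rpow_nonneg (hg _) _) (by positivity)) _
    rw [sum_cube_succ]
    refine Finset.sum_le_sum fun a _ => ?_
    simp only [sum_cube_succ (n := n)]
    rw [Finset.sum_comm]
    refine Finset.sum_le_sum fun b _ => ?_
    refine (mul_le_mul_of_nonneg_left (ih (fun i => μ i.succ) (fun i => hnn _) (fun i => hx _)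
      (fun i => hy _) (fun i => hcor _) (fun x => f (Fin.cons a x)) (fun y => g (Fin.cons b y))
      (fun _ => hf _) (fun _ => hg _)) (hnn 0 (a, b))).trans_eq ?_
    simp only [Fin.prod_univ_succ, Fin.cons_zero, Fin.cons_succ, Finset.mul_sum, mul_assoc]

theorem sum_indicator_rpow {α : Type*} [Fintype α] [DecidableEq α] (B : Finset α) {p : ℝ}
    (hp : p ≠ 0) : ∑ x, (if x ∈ B then (1 : ℝ) else 0) ^ p = B.card := by
  simp [apply_ite (fun t : ℝ => t ^ p), Real.zero_rpow hp]

/-- Corollary of reverse hypercontractivity: if `(x_i,y_i)` are independent across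
coordinates with uniform ±1 marginals and `|E[x_i y_i]| ≤ ρ`, and
`P[x ∈ B₁] ≥ ε`, `P[y ∈ B₂] ≥ ε` for `0 < ε ≤ 1`, then
`P[x ∈ B₁, y ∈ B₂] ≥ ε^{2/(1-ρ)}`. -/
theorem stmt_4 (n : ℕ) (μ : Fin n → Bool × Bool → ℝ)
    (hnn : ∀ i p, 0 ≤ μ i p)
    (hmargx : ∀ i b, μ i (b, true) + μ i (b, false) = 1/2)
    (hmargy : ∀ i b, μ i (true, b) + μ i (false, b) = 1/2)
    (ρ : ℝ) (hρ0 : 0 ≤ ρ) (hρ1 : ρ < 1)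
    (hcor : ∀ i, |∑ p : Bool × Bool, μ i p * (sgn p.1 * sgn p.2)| ≤ ρ)
    (ε : ℝ) (hε0 : 0 < ε) (hε1 : ε ≤ 1)
    (B₁ B₂ : Finset (Fin n → Bool))
    (hB₁ : ε ≤ (B₁.card : ℝ) / 2^n)
    (hB₂ : ε ≤ (B₂.card : ℝ) / 2^n) :
    ε ^ (2 / (1 - ρ)) ≤ ∑ x ∈ B₁, ∑ y ∈ B₂, ∏ i, μ i (x i, y i) := by
  have hp : 0 < 1 - ρ := by linarith
  have h := reverse_hypercontractive hρ0 hρ1 n μ hnn hmargx hmargy hcor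
    (fun x => if x ∈ B₁ then 1 else 0) (fun y => if y ∈ B₂ then 1 else 0)
    (fun x => by positivity) (fun y => by positivity)
  rw [sum_indicator_rpow B₁ hp.ne', sum_indicator_rpow B₂ hp.ne'] at h
  calc ε ^ (2 / (1 - ρ)) = ε ^ (1 / (1 - ρ)) * ε ^ (1 / (1 - ρ)) := by
        rw [← Real.rpow_add hε0]
        ring_nf
    _ ≤ _ := by gcongr
    _ ≤ _ := h
    _ = _ := by
      simp only [mul_ite, mul_one, mul_zero, Finset.sum_ite_mem, Finset.univ_inter]
      rw [Finset.sum_comm]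
      simp only [Finset.sum_ite_mem, Finset.univ_inter]
      exact Finset.sum_comm
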